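/- For every σ ≥ 1 there exists a constant C > 0 depending only on p and σ such that the following holds: for every σ-quasi-uniform partition of [a,b], every piecewise polynomial u^R = (P₀,…,P_N) of degree ≤ p with respect to it, every function u that is (p+1)-times continuously differentiable on [a,b], and every constant K ≥ 0, if ‖u − u^R‖_{L¹(a,b)} ≤ K h^{p+1}, then Σ_{i=1}^{N} h ‖D_i‖ ≤ C (K + |u|_{W^{p+1}_1}). (That is, optimal-order L¹ convergence implies W^{p+1}_1 numerical smoothness of Type A.) -/

import Mathlib

open MeasureTheory

noncomputable section

/-- Maximal mesh size `h` of the partition `x 0 < x 1 < ... < x (N+1)`. -/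
def meshH (N : ℕ) (x : ℕ → ℝ) : ℝ :=
  (Finset.range (N + 1)).sup' (Finset.nonempty_range_iff.mpr (Nat.succ_ne_zero N))
    (fun i => x (i + 1) - x i)

/-- Minimal mesh size `h_min`. -/
def meshHmin (N : ℕ) (x : ℕ → ℝ) : ℝ :=
  (Finset.range (N + 1)).inf' (Finset.nonempty_range_iff.mpr (Nat.succ_ne_zero N))
    (fun i => x (i + 1) - x i)

/-- Jump of the `k`-th derivative of the piecewise polynomial `P` at the node `x i`. -/
def jumpD (P : ℕ → Polynomial ℝ) (x : ℕ → ℝ) (i k : ℕ) : ℝ :=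
  (Polynomial.derivative^[k] (P i)).eval (x i)
    - (Polynomial.derivative^[k] (P (i - 1))).eval (x i)

/-- Euclidean norm of the scaled jump vector `D_i = (J_i^(k) / h^(p+1-k))_{k=0}^p`. -/
def normD (p N : ℕ) (x : ℕ → ℝ) (P : ℕ → Polynomial ℝ) (i : ℕ) : ℝ :=
  Real.sqrt (∑ k ∈ Finset.range (p + 1),
    (jumpD P x i k / meshH N x ^ (p + 1 - k)) ^ 2)

/-- `L¹` distance between `u` and the piecewise polynomial `u^R` defined by `P`. -/
def distL1 (N : ℕ) (x : ℕ → ℝ) (P : ℕ → Polynomial ℝ) (u : ℝ → ℝ) : ℝ :=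
  ∑ i ∈ Finset.range (N + 1), ∫ t in (x i)..(x (i + 1)), |u t - (P i).eval t|

/-- Sobolev seminorm `|u|_{W^{p+1}_1}` on `(a,b)`. -/
def semiW1 (p : ℕ) (a b : ℝ) (u : ℝ → ℝ) : ℝ :=
  ∫ t in a..b, |iteratedDerivWithin (p + 1) u (Set.Icc a b) t|

lemma aux_pos (p : ℕ) (c : Fin (p+1) → ℝ) (hc : c ≠ 0) :
    0 < ∫ t in (0:ℝ)..1, |∑ k, c k * t ^ (k:ℕ)| := by
  apply intervalIntegral.integral_pos one_pos
  · fun_prop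
  · intro t _; positivity
  · by_contra! hcon
    apply hc
    let q : Polynomial ℝ := ∑ k : Fin (p+1), Polynomial.C (c k) * Polynomial.X ^ (k:ℕ)
    have hq : q = 0 := by
      apply Polynomial.eq_zero_of_infinite_isRoot
      apply (Set.Icc_infinite (one_pos : (0:ℝ) < 1)).mono
      intro t ht
      have h := abs_nonpos_iff.1 (hcon t ht)
      simpa [q, Polynomial.IsRoot, Polynomial.eval_finsetSum] using h
    funext k
    have : q.coeff k = 0 := by rw [hq]; simp
    simpa [q, Polynomial.finsetSum_coeff, Polynomial.coeff_X_pow, Fin.val_inj] using this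

lemma aux_norm (p : ℕ) : ∃ M : ℝ, 0 < M ∧ ∀ c : Fin (p+1) → ℝ, 
    ‖c‖ ≤ M * ∫ t in (0:ℝ)..1, |∑ k, c k * t ^ (k:ℕ)| := by
  have hcont : Continuous fun c : Fin (p+1) → ℝ => ∫ t in (0:ℝ)..1, |∑ k, c k * t ^ (k:ℕ)| := by
    apply intervalIntegral.continuous_parametric_intervalIntegral_of_continuous'
    fun_prop
  obtain ⟨c₀, hc₀, hmin⟩ := (isCompact_sphere (0 : Fin (p+1) → ℝ) 1).exists_isMinOn
    (NormedSpace.sphere_nonempty.2 zero_le_one) hcont.continuousOn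
  have hne : c₀ ≠ 0 := by
    rintro rfl
    simp at hc₀
  have hm := aux_pos p c₀ hne
  set m := ∫ t in (0:ℝ)..1, |∑ k, c₀ k * t ^ (k:ℕ)| with hmdef
  refine ⟨m⁻¹, by positivity, fun c => ?_⟩
  by_cases hc : c = 0
  · simp [hc]
  have hn : 0 < ‖c‖ := norm_pos_iff.2 hc
  have hs : ‖c‖⁻¹ • c ∈ Metric.sphere (0 : Fin (p+1) → ℝ) 1 := by
    simp [norm_smul, hn.ne']
  have := hmin hs
  simp only [Set.mem_ofPred_eq] at this
  have e : ∫ t in (0:ℝ)..1, |∑ k, (‖c‖⁻¹ • c) k * t ^ (k:ℕ)| = 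
    ‖c‖⁻¹ * ∫ t in (0:ℝ)..1, |∑ k, c k * t ^ (k:ℕ)| := by
    rw [← intervalIntegral.integral_const_mul]
    congr 1; funext t
    rw [← abs_of_pos (inv_pos.2 hn), ← abs_mul, Finset.mul_sum, abs_of_pos (inv_pos.2 hn)]
    simp [mul_assoc]
  rw [e, ← hmdef] at this
  rw [inv_mul_eq_div, le_div_iff₀ hm]
  rwa [inv_mul_eq_div, le_div_iff₀ hn, mul_comm] at this

lemma aux_inverse (p : ℕ) : ∃ M : ℝ, 0 < M ∧ ∀ Q : Polynomial ℝ, Q.natDegree ≤ p →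
    ∀ k ≤ p, ∀ c d : ℝ,
    |(Polynomial.derivative^[k] Q).eval c| * |d - c| ^ (k+1) ≤
      M * |∫ t in c..d, (|Q.eval t|)| := by
  obtain ⟨M, hM, h⟩ := aux_norm p
  refine ⟨(p.factorial : ℝ) * M, by positivity, fun Q hQ k hk c d => ?_⟩
  set s := d - c with hs
  let v : Fin (p+1) → ℝ := fun j => (Polynomial.taylor c Q).coeff j * s ^ (j:ℕ)
  have hv : ∀ t : ℝ, ∑ j, v j * t ^ (j:ℕ) = Q.eval (c + s * t) := by
    intro t
    have h1 : Q.eval (c + s * t) = (Polynomial.taylor c Q).eval (s * t) := by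
      rw [Polynomial.taylor_eval, add_comm]
    rw [h1, Polynomial.eval_eq_sum_range' (n := p+1) (by
      rw [Polynomial.natDegree_taylor]; omega), Finset.sum_range]
    refine Finset.sum_congr rfl fun j _ => ?_
    simp only [v]; ring
  have h1 := h v
  simp only [hv] at h1
  have h2 := (norm_le_pi_norm v ⟨k, by omega⟩).trans h1
  have h3 : (Polynomial.derivative^[k] Q).eval c = k.factorial * (Polynomial.taylor c Q).coeff k := by
    rw [Polynomial.taylor_coeff, ← Polynomial.factorial_smul_hasseDeriv]
    simp
  have h4 : s * ∫ t in (0:ℝ)..1, |Q.eval (c + s * t)| = ∫ t in c..d, |Q.eval t| := by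
    have := intervalIntegral.mul_integral_comp_add_mul (a := 0) (b := 1) 
      (f := fun t => |Q.eval t|) s c
    simpa [hs] using this
  have h5 : 0 ≤ ∫ t in (0:ℝ)..1, |Q.eval (c + s * t)| := 
    intervalIntegral.integral_nonneg zero_le_one fun t _ => abs_nonneg _
  rw [← h4, h3, abs_mul, abs_mul, abs_of_nonneg h5]
  simp only [v, Real.norm_eq_abs, abs_mul, abs_pow] at h2
  have hf : (k.factorial : ℝ) ≤ p.factorial := by exact_mod_cast Nat.factorial_le hk
  rw [Nat.abs_cast]
  calc _ = (k.factorial : ℝ) * |s| * (|(Polynomial.taylor c Q).coeff k| * |s| ^ k) := by ring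
    _ ≤ (p.factorial : ℝ) * |s| * (M * ∫ t in (0:ℝ)..1, |Q.eval (c + s * t)|) := by gcongr
    _ = _ := by ring

lemma aux_taylor (p : ℕ) (a b : ℝ) (hab : a < b) (u : ℝ → ℝ)
    (hu : ContDiffOn ℝ (p + 1 : ℕ) u (Set.Icc a b)) (c : ℝ) (hc : c ∈ Set.Icc a b) :
    ∃ T : Polynomial ℝ, T.natDegree ≤ p ∧ ∀ t ∈ Set.Icc a b, |u t - T.eval t| ≤
      |t - c| ^ p * |∫ s in c..t, (|iteratedDerivWithin (p + 1) u (Set.Icc a b) s|)| := by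
  refine ⟨∑ k ∈ Finset.range (p+1), Polynomial.C ((k.factorial : ℝ)⁻¹ *
    iteratedDerivWithin k u (Set.Icc a b) c) * (Polynomial.X - Polynomial.C c) ^ k, ?_, ?_⟩
  · apply Polynomial.natDegree_sum_le_of_forall_le
    intro k hk
    refine (Polynomial.natDegree_C_mul_le _ _).trans ?_
    rw [Polynomial.natDegree_pow, Polynomial.natDegree_X_sub_C]
    simp at hk; omega
  intro t ht
  by_cases htc : t = c
  · subst htc
    simp [Polynomial.eval_finsetSum, Finset.sum_range_succ']
  have hsub : Set.uIcc c t ⊆ Set.Icc a b := Set.uIcc_subset_Icc hc ht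
  have hU : UniqueDiffOn ℝ (Set.uIcc c t) := uniqueDiffOn_uIcc (Ne.symm htc)
  have hI : UniqueDiffOn ℝ (Set.Icc a b) := uniqueDiffOn_Icc hab
  have key : ∀ k ≤ p + 1, ∀ s ∈ Set.uIcc c t, iteratedDerivWithin k u (Set.uIcc c t) s = 
      iteratedDerivWithin k u (Set.Icc a b) s := by
    intro k hk s hs
    rw [iteratedDerivWithin, iteratedDerivWithin, iteratedFDerivWithin_subset hsub hU hI
      (hu.of_le (by exact_mod_cast hk)) hs]
  have hT := taylor_integral_remainder (hu.mono hsub)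
  have e : taylorWithinEval u p (Set.uIcc c t) c t = Polynomial.eval t (∑ k ∈ Finset.range (p+1), 
    Polynomial.C ((k.factorial : ℝ)⁻¹ *
    iteratedDerivWithin k u (Set.Icc a b) c) * (Polynomial.X - Polynomial.C c) ^ k) := by
    rw [taylor_within_apply, Polynomial.eval_finsetSum]
    refine Finset.sum_congr rfl fun k hk => ?_
    rw [key k (by simp at hk; omega) c Set.left_mem_uIcc]
    simp only [Polynomial.eval_mul, Polynomial.eval_C, Polynomial.eval_pow, Polynomial.eval_sub,
      Polynomial.eval_X, smul_eq_mul]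
    ring
  rw [← e, hT]
  have hg : ContinuousOn (iteratedDerivWithin (p+1) u (Set.Icc a b)) (Set.Icc a b) :=
    hu.continuousOn_iteratedDerivWithin le_rfl hI
  rw [← abs_of_nonneg (show (0:ℝ) ≤ |t - c| ^ p by positivity), ← abs_mul, 
    ← intervalIntegral.integral_const_mul, ← Real.norm_eq_abs]
  apply intervalIntegral.norm_integral_le_abs_of_norm_le
  · filter_upwards [ae_restrict_mem measurableSet_uIoc] with s hs
    have hs' := Set.uIoc_subset_uIcc hs
    rw [key _ le_rfl s hs', norm_smul, Real.norm_eq_abs, Real.norm_eq_abs]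
    gcongr
    rw [abs_div, abs_pow, Nat.abs_cast]
    have h1 : |t - s| ≤ |t - c| := by
      exact Set.abs_sub_right_of_mem_uIcc hs'
    calc |t - s| ^ p / p.factorial ≤ |t - s| ^ p := 
          div_le_self (by positivity) (by exact_mod_cast Nat.one_le_iff_ne_zero.2 (Nat.factorial_ne_zero p))
      _ ≤ _ := by gcongr
  · apply ContinuousOn.intervalIntegrable
    exact continuousOn_const.mul (hg.mono hsub).abs

lemma aux_local (p : ℕ) : ∃ M : ℝ, 0 < M ∧ ∀ (a b : ℝ), a < b → ∀ u : ℝ → ℝ,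
    ContDiffOn ℝ (p + 1 : ℕ) u (Set.Icc a b) → ∀ c ∈ Set.Icc a b, 
    ∃ T : Polynomial ℝ, ∀ d ∈ Set.Icc a b, ∀ Q : Polynomial ℝ, Q.natDegree ≤ p → ∀ k ≤ p,
      |(Polynomial.derivative^[k] (Q - T)).eval c| * |d - c| ^ (k+1) ≤
      M * (|∫ t in c..d, (|u t - Q.eval t|)| + |d - c| ^ (p+1) * 
        |∫ s in c..d, (|iteratedDerivWithin (p + 1) u (Set.Icc a b) s|)|) := by
  obtain ⟨M, hM, h⟩ := aux_inverse p
  refine ⟨M, hM, fun a b hab u hu c hc => ?_⟩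
  obtain ⟨T, hT, hTb⟩ := aux_taylor p a b hab u hu c hc
  refine ⟨T, fun d hd Q hQ k hk => ?_⟩
  refine (h (Q - T) ((Polynomial.natDegree_sub_le _ _).trans (max_le hQ hT)) k hk c d).trans ?_
  gcongr
  have hsub : Set.uIcc c d ⊆ Set.Icc a b := Set.uIcc_subset_Icc hc hd
  have hg : ContinuousOn (iteratedDerivWithin (p+1) u (Set.Icc a b)) (Set.Icc a b) :=
    hu.continuousOn_iteratedDerivWithin le_rfl (uniqueDiffOn_Icc hab)
  have hc1 : ∀ R : Polynomial ℝ, IntervalIntegrable (fun t => |u t - R.eval t|) volume c d := by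
    intro R
    apply ContinuousOn.intervalIntegrable
    exact ((hu.continuousOn.mono hsub).sub (by fun_prop)).abs
  have h1 : |∫ t in c..d, (|(Q - T).eval t|)| ≤ 
      |∫ t in c..d, (|u t - Q.eval t| + |u t - T.eval t|)| := by
    rw [← Real.norm_eq_abs]
    apply intervalIntegral.norm_integral_le_abs_of_norm_le
    · filter_upwards with t
      rw [Real.norm_eq_abs, abs_abs, Polynomial.eval_sub, 
        show Q.eval t - T.eval t = -(u t - Q.eval t) + (u t - T.eval t) by ring]
      refine (abs_add_le _ _).trans ?_
      rw [abs_neg]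
    · exact (hc1 Q).add (hc1 T)
  refine h1.trans ?_
  rw [intervalIntegral.integral_add (hc1 Q) (hc1 T)]
  refine (abs_add_le _ _).trans ?_
  gcongr
  rw [← Real.norm_eq_abs]
  refine (intervalIntegral.norm_integral_le_of_norm_le_const 
    (C := |d - c| ^ p * |∫ s in c..d, (|iteratedDerivWithin (p + 1) u (Set.Icc a b) s|)|) ?_).trans
    (le_of_eq (by ring))
  intro t ht
  have ht' := Set.uIoc_subset_uIcc ht
  rw [Real.norm_eq_abs, abs_abs]
  refine (hTb t (hsub ht')).trans ?_
  have h2 : |t - c| ≤ |d - c| := Set.abs_sub_left_of_mem_uIcc ht'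
  refine mul_le_mul (pow_le_pow_left₀ (abs_nonneg _) h2 p) ?_ (abs_nonneg _) (by positivity)
  apply intervalIntegral.abs_integral_mono_interval
  · exact Set.uIoc_subset_uIoc_of_uIcc_subset_uIcc (Set.uIcc_subset_uIcc_left ht')
  · filter_upwards with s using abs_nonneg _
  · exact ((hg.mono hsub).abs).intervalIntegrable

/-- Optimal-order `L¹` convergence implies `W^{p+1}_1` numerical smoothness of Type A. -/
theorem optimal_l1_convergence_implies_smoothness (p : ℕ) (σ : ℝ) (hσ : 1 ≤ σ) :
    ∃ C : ℝ, 0 < C ∧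
      ∀ (N : ℕ), 1 ≤ N → ∀ (a b : ℝ), a < b →
      ∀ (x : ℕ → ℝ), x 0 = a → x (N + 1) = b → (∀ i ≤ N, x i < x (i + 1)) →
      meshH N x ≤ σ * meshHmin N x →
      ∀ (P : ℕ → Polynomial ℝ), (∀ i ≤ N, (P i).natDegree ≤ p) →
      ∀ (u : ℝ → ℝ), ContDiffOn ℝ (p + 1 : ℕ) u (Set.Icc a b) →
      ∀ (K : ℝ), 0 ≤ K →
      distL1 N x P u ≤ K * meshH N x ^ (p + 1) →
      ∑ i ∈ Finset.Icc 1 N, meshH N x * normD p N x P i ≤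
        C * (K + semiW1 p a b u) := by
  obtain ⟨M, hM, hloc⟩ := aux_local p
  refine ⟨2 * ((p + 1) * (M * σ ^ (p+1))), by positivity, ?_⟩
  intro N hN a b hab x hx0 hxN hmono hqu P hP u hu K hK hdist
  set h := meshH N x with hh
  have hle : ∀ i ≤ N, x (i+1) - x i ≤ h := fun i hi =>
    Finset.le_sup' (fun i => x (i + 1) - x i) (Finset.mem_range.2 (by omega))
  have hmin : ∀ i ≤ N, meshHmin N x ≤ x (i+1) - x i := fun i hi =>
    Finset.inf'_le (fun i => x (i + 1) - x i) (Finset.mem_range.2 (by omega))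
  have hpos : 0 < h := lt_of_lt_of_le (sub_pos.2 (hmono 0 (by omega))) (hle 0 (by omega))
  have hσl : ∀ i ≤ N, h ≤ σ * (x (i+1) - x i) := fun i hi =>
    hqu.trans (mul_le_mul_of_nonneg_left (hmin i hi) (by linarith))
  have hxa : ∀ i ≤ N + 1, a ≤ x i := by
    intro i
    induction i with
    | zero => intro _; rw [hx0]
    | succ n ih => intro hn; exact (ih (by omega)).trans (hmono n (by omega)).le
  have hxb : ∀ j ≤ N + 1, x (N + 1 - j) ≤ b := by
    intro j
    induction j with
    | zero => intro _; simp [hxN]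
    | succ n ih =>
      intro hn
      refine le_trans ?_ (ih (by omega))
      have := hmono (N + 1 - (n+1)) (by omega)
      rw [show N + 1 - (n+1) + 1 = N + 1 - n by omega] at this
      exact this.le
  have hxI : ∀ i ≤ N + 1, x i ∈ Set.Icc a b := fun i hi => ⟨hxa i hi, by
    have := hxb (N + 1 - i) (by omega)
    rwa [show N + 1 - (N + 1 - i) = i by omega] at this⟩
  set g : ℝ → ℝ := fun s => |iteratedDerivWithin (p + 1) u (Set.Icc a b) s| with hgdef
  have hg : ContinuousOn g (Set.Icc a b) :=
    (hu.continuousOn_iteratedDerivWithin le_rfl (uniqueDiffOn_Icc hab)).abs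
  let E : ℕ → ℝ := fun i => ∫ t in (x i)..(x (i + 1)), |u t - (P i).eval t|
  let G : ℕ → ℝ := fun i => ∫ t in (x i)..(x (i + 1)), g t
  have hE0 : ∀ i ≤ N, 0 ≤ E i := fun i hi =>
    intervalIntegral.integral_nonneg (hmono i hi).le fun t _ => abs_nonneg _
  have hG0 : ∀ i ≤ N, 0 ≤ G i := fun i hi =>
    intervalIntegral.integral_nonneg (hmono i hi).le fun t _ => abs_nonneg _
  have hGsum : ∑ i ∈ Finset.range (N+1), G i = semiW1 p a b u := by
    have := intervalIntegral.sum_integral_adjacent_intervals (f := g) (μ := volume) (a := x)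
      (n := N + 1) (fun k hk => (hg.mono (Set.uIcc_subset_Icc (hxI k (by omega))
        (hxI (k+1) (by omega)))).intervalIntegrable)
    rw [hx0, hxN] at this
    exact this
  -- scaled derivative bound from a local estimate
  have hscale : ∀ (A l B e γ : ℝ) (k : ℕ), k ≤ p → 0 ≤ A → 0 < l → l ≤ h → h ≤ σ * l → 0 ≤ γ →
      A * l ^ (k+1) ≤ M * (e + l ^ (p+1) * γ) →
      A * h ^ (k+1) ≤ M * σ ^ (p+1) * (e + h ^ (p+1) * γ) := by
    intro A l B e γ k hk hA hl hlh hhl hγ hb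
    calc A * h ^ (k+1) ≤ A * (σ * l) ^ (k+1) := by gcongr
      _ = σ ^ (k+1) * (A * l ^ (k+1)) := by ring
      _ ≤ σ ^ (p+1) * (A * l ^ (k+1)) := by gcongr
      _ ≤ σ ^ (p+1) * (M * (e + l ^ (p+1) * γ)) := by gcongr
      _ ≤ σ ^ (p+1) * (M * (e + h ^ (p+1) * γ)) := by gcongr
      _ = _ := by ring
  have hnode : ∀ j < N, h * normD p N x P (j+1) ≤
      (p + 1) * (M * σ ^ (p+1)) * ((E (j+1) + E j) / h ^ (p+1) + (G (j+1) + G j)) := by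
    intro j hj
    obtain ⟨T, hT⟩ := hloc a b hab u hu (x (j+1)) (hxI _ (by omega))
    have hJ : ∀ k ≤ p, |jumpD P x (j+1) k| * h ^ (k+1) ≤
        M * σ ^ (p+1) * ((E (j+1) + E j) + h ^ (p+1) * (G (j+1) + G j)) := by
      intro k hk
      have h1 := hT (x (j+1+1)) (hxI _ (by omega)) (P (j+1)) (hP _ (by omega)) k hk
      have h2 := hT (x j) (hxI _ (by omega)) (P j) (hP _ (by omega)) k hk
      have m1 := hmono (j+1) (by omega)
      have m2 := hmono j (by omega)
      rw [abs_of_pos (sub_pos.2 m1)] at h1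
      rw [abs_sub_comm (x j), abs_of_pos (sub_pos.2 m2), intervalIntegral.integral_symm, abs_neg,
        intervalIntegral.integral_symm (x j), abs_neg] at h2
      change _ ≤ M * (|E (j+1)| + _ * |G (j+1)|) at h1
      change _ ≤ M * (|E j| + _ * |G j|) at h2
      rw [abs_of_nonneg (hE0 _ (by omega)), abs_of_nonneg (hG0 _ (by omega))] at h1 h2
      have h1' := hscale _ _ 0 _ _ k hk (abs_nonneg _) (sub_pos.2 m1) (hle _ (by omega))
        (hσl _ (by omega)) (hG0 _ (by omega)) h1
      have h2' := hscale _ _ 0 _ _ k hk (abs_nonneg _) (sub_pos.2 m2) (hle _ (by omega))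
        (hσl _ (by omega)) (hG0 _ (by omega)) h2
      have hJ' : |jumpD P x (j+1) k| ≤
          |(Polynomial.derivative^[k] (P (j+1) - T)).eval (x (j+1))| +
          |(Polynomial.derivative^[k] (P j - T)).eval (x (j+1))| := by
        rw [Polynomial.iterate_derivative_sub, Polynomial.iterate_derivative_sub]
        refine le_trans (le_of_eq ?_) (abs_sub _ _)
        simp [jumpD]
      have h3 := mul_le_mul_of_nonneg_right hJ' (by positivity : 0 ≤ h ^ (k+1))
      rw [add_mul] at h3
      refine (h3.trans (add_le_add h1' h2')).trans (le_of_eq ?_)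
      ring
    have hn : normD p N x P (j+1) ≤
        ∑ k ∈ Finset.range (p+1), |jumpD P x (j+1) k| / h ^ (p+1-k) := by
      apply Real.sqrt_le_iff.2
      refine ⟨Finset.sum_nonneg fun k _ => by positivity, ?_⟩
      refine le_trans (le_of_eq ?_) (Finset.sum_sq_le_sq_sum_of_nonneg fun k _ => by positivity)
      refine Finset.sum_congr rfl fun k _ => ?_
      rw [div_pow, div_pow, sq_abs]
    calc h * normD p N x P (j+1) ≤
        h * ∑ k ∈ Finset.range (p+1), |jumpD P x (j+1) k| / h ^ (p+1-k) := by gcongr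
      _ ≤ ∑ k ∈ Finset.range (p+1), (M * σ ^ (p+1)) *
          ((E (j+1) + E j) / h ^ (p+1) + (G (j+1) + G j)) := by
        rw [Finset.mul_sum]
        refine Finset.sum_le_sum fun k hk => ?_
        have hk' : k ≤ p := by simp at hk; omega
        have e1 : h * (|jumpD P x (j+1) k| / h ^ (p+1-k)) =
            |jumpD P x (j+1) k| * h ^ (k+1) / h ^ (p+1) := by
          have : h ^ (p+1) = h ^ (p+1-k) * h ^ k := by rw [← pow_add]; congr 1; omega
          rw [this]
          field_simp
          ring
        rw [e1, div_le_iff₀ (by positivity)]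
        refine (hJ k hk').trans (le_of_eq ?_)
        field_simp
      _ = _ := by simp; ring
  have hIcc : ∑ i ∈ Finset.Icc 1 N, h * normD p N x P i =
      ∑ j ∈ Finset.range N, h * normD p N x P (j+1) := by
    rw [Finset.range_eq_Ico, Finset.sum_Ico_add' (fun i => h * normD p N x P i) 0 N 1]
    rfl
  have htwo : ∀ F : ℕ → ℝ, (∀ i ≤ N, 0 ≤ F i) →
      ∑ j ∈ Finset.range N, (F (j+1) + F j) ≤ 2 * ∑ i ∈ Finset.range (N+1), F i := by
    intro F hF
    rw [Finset.sum_add_distrib]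
    have e1 := Finset.sum_range_succ F N
    have e2 := Finset.sum_range_succ' F N
    have := hF 0 (by omega)
    have := hF N le_rfl
    linarith
  have hEs : (∑ i ∈ Finset.range (N+1), E i) / h ^ (p+1) ≤ K := by
    rw [div_le_iff₀ (by positivity)]
    exact hdist
  rw [hIcc]
  calc _ ≤ ∑ j ∈ Finset.range N, (p + 1) * (M * σ ^ (p+1)) *
        ((E (j+1) + E j) / h ^ (p+1) + (G (j+1) + G j)) :=
        Finset.sum_le_sum fun j hj => hnode j (Finset.mem_range.1 hj)
    _ = (p + 1) * (M * σ ^ (p+1)) * ((∑ j ∈ Finset.range N, (E (j+1) + E j)) / h ^ (p+1) +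
        ∑ j ∈ Finset.range N, (G (j+1) + G j)) := by
        rw [← Finset.mul_sum, Finset.sum_add_distrib, Finset.sum_div]
    _ ≤ (p + 1) * (M * σ ^ (p+1)) * ((2 * ∑ i ∈ Finset.range (N+1), E i) / h ^ (p+1) +
        2 * ∑ i ∈ Finset.range (N+1), G i) := by
        gcongr
        · exact htwo E hE0
        · exact htwo G hG0
    _ = 2 * ((p + 1) * (M * σ ^ (p+1))) * ((∑ i ∈ Finset.range (N+1), E i) / h ^ (p+1) +
        ∑ i ∈ Finset.range (N+1), G i) := by ring
    _ ≤ _ := by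
        rw [hGsum]
        gcongr

end
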